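/- arXiv:1610.07554 — 7 statements merged into one kernel-verified Lean document; each statement's English description precedes it below -/
import Mathlib

section
/- For integers n ≥ 2 and 1 ≤ i ≤ j ≤ n−1, set p* = (1 + (∏_{k=i}^{j} (n−k)/k)^{1/(j−i+1)})^{−1}. Then the function f(p) = ∑_{x=i}^{j} C(n,x) p^x (1−p)^{n−x} is continuous on [0,1], strictly increasing on [0, p*], and strictly decreasing on [p*, 1]; in particular f attains its maximum over [0,1] at p = p*. -/
/-- The ratios `(n - k) / k` telescope against the weights `k * C(n, k)`. -/
theorem mul_choose_mul_prod_sub_div (n i j : ℕ) (hi : 1 ≤ i) (hij : i ≤ j) (hj : j ≤ n) :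
    (i : ℝ) * n.choose i * ∏ k ∈ Finset.Icc i j, ((n : ℝ) - (k : ℝ)) / (k : ℝ) =
      ((j + 1 : ℕ) : ℝ) * n.choose (j + 1) := by
  have succ_mul_choose (k : ℕ) (hk : k ≤ n) :
      ((k + 1 : ℕ) : ℝ) * n.choose (k + 1) = n.choose k * ((n : ℝ) - k) := by
    rw [← Nat.cast_sub hk, mul_comm]
    exact_mod_cast Nat.choose_succ_right_eq n k
  induction j, hij using Nat.le_induction with
  | base =>
    have hi0 : (i : ℝ) ≠ 0 := by positivity
    rw [succ_mul_choose i hj, Finset.Icc_self, Finset.prod_singleton]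
    field_simp
  | succ j hij ih =>
    have hj0 : ((j + 1 : ℕ) : ℝ) ≠ 0 := by positivity
    rw [Finset.prod_Icc_succ_top (by omega), ← mul_assoc, ih (by omega),
      succ_mul_choose (j + 1) hj]
    field_simp

theorem hasDerivAt_binomial_term (n x : ℕ) (p : ℝ) :
    HasDerivAt (fun p : ℝ => (n.choose x : ℝ) * p ^ x * (1 - p) ^ (n - x))
      ((x : ℝ) * n.choose x * p ^ (x - 1) * (1 - p) ^ (n - x) -
        ((x + 1 : ℕ) : ℝ) * n.choose (x + 1) * p ^ x * (1 - p) ^ (n - (x + 1))) p := by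
  have h := ((hasDerivAt_pow x p).const_mul (n.choose x : ℝ)).mul
    (((hasDerivAt_id p).const_sub 1).pow (n - x))
  refine h.congr_deriv ?_
  have hc : ((x + 1 : ℕ) : ℝ) * n.choose (x + 1) = n.choose x * ((n - x : ℕ) : ℝ) := by
    rw [mul_comm]
    exact_mod_cast Nat.choose_succ_right_eq n x
  rw [hc, Nat.sub_add_eq]
  simp only [id, Pi.pow_apply]
  ring

/-- The derivative of a binomial interval probability telescopes to two boundary terms. -/
theorem hasDerivAt_binomial_interval_prob (n i j : ℕ) (hij : i ≤ j) (p : ℝ) :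
    HasDerivAt
      (fun p : ℝ => ∑ x ∈ Finset.Icc i j, (n.choose x : ℝ) * p ^ x * (1 - p) ^ (n - x))
      ((i : ℝ) * n.choose i * p ^ (i - 1) * (1 - p) ^ (n - i) -
        ((j + 1 : ℕ) : ℝ) * n.choose (j + 1) * p ^ j * (1 - p) ^ (n - (j + 1))) p := by
  induction j, hij using Nat.le_induction with
  | base => simpa only [Finset.Icc_self, Finset.sum_singleton] using
      hasDerivAt_binomial_term n i p
  | succ j hij ih =>
    simp only [Finset.sum_Icc_succ_top (show i ≤ j + 1 by omega)]
    refine (ih.add (hasDerivAt_binomial_term n (j + 1) p)).congr_deriv ?_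
    rw [Nat.add_sub_cancel]
    ring

/-- For `2 ≤ n` and `1 ≤ i ≤ j ≤ n - 1`, with
`p* = (1 + (∏_{k=i}^{j} (n-k)/k)^{1/(j-i+1)})⁻¹`, the function
`f(p) = ∑_{x=i}^{j} C(n,x) p^x (1-p)^{n-x}` is continuous on `[0,1]`, strictly increasing
on `[0,p*]`, strictly decreasing on `[p*,1]`, and attains its maximum over `[0,1]` at `p*`. -/
theorem binomial_interval_prob_unimodal (n i j : ℕ) (hn : 2 ≤ n) (hi : 1 ≤ i) (hij : i ≤ j)
    (hj : j ≤ n - 1) :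
    let pstar : ℝ :=
      (1 + (∏ k ∈ Finset.Icc i j, ((n : ℝ) - (k : ℝ)) / (k : ℝ)) ^
        ((1 : ℝ) / ((j : ℝ) - (i : ℝ) + 1)))⁻¹
    let f : ℝ → ℝ := fun p => ∑ x ∈ Finset.Icc i j, (n.choose x : ℝ) * p ^ x * (1 - p) ^ (n - x)
    ContinuousOn f (Set.Icc 0 1) ∧ StrictMonoOn f (Set.Icc 0 pstar) ∧
      StrictAntiOn f (Set.Icc pstar 1) ∧ ∀ p ∈ Set.Icc (0 : ℝ) 1, f p ≤ f pstar := by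
  intro pstar f
  have hjn : j < n := by omega
  have hcont : Continuous f := by fun_prop
  have hR : 0 < ∏ k ∈ Finset.Icc i j, ((n : ℝ) - (k : ℝ)) / (k : ℝ) := by
    refine Finset.prod_pos fun k hk => ?_
    rw [Finset.mem_Icc] at hk
    have hk0 : (0 : ℝ) < k := by exact_mod_cast (by omega : 0 < k)
    have hkn : (k : ℝ) < n := by exact_mod_cast (by omega : k < n)
    exact div_pos (sub_pos.2 hkn) hk0
  have hprod := mul_choose_mul_prod_sub_div n i j hi hij hjn.le
  obtain ⟨r, hr⟩ : ∃ r : ℝ, r = (∏ k ∈ Finset.Icc i j, ((n : ℝ) - (k : ℝ)) / (k : ℝ)) ^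
      ((1 : ℝ) / ((j : ℝ) - (i : ℝ) + 1)) := ⟨_, rfl⟩
  have hr0 : 0 < r := hr ▸ Real.rpow_pos_of_pos hR _
  have hrm : r ^ (j - i + 1) = ∏ k ∈ Finset.Icc i j, ((n : ℝ) - (k : ℝ)) / (k : ℝ) := by
    have hm : (j : ℝ) - (i : ℝ) + 1 = ((j - i + 1 : ℕ) : ℝ) := by
      push_cast [Nat.cast_sub hij]
      ring
    rw [hr, hm, one_div, Real.rpow_inv_natCast_pow hR.le (by omega)]
  have hpstar : pstar = (1 + r)⁻¹ := by rw [hr]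
  have hpstar0 : 0 < pstar := by rw [hpstar]; positivity
  have hpstar1 : pstar < 1 := by rw [hpstar]; exact inv_lt_one_of_one_lt₀ (by linarith)
  have hpr : pstar * (1 + r) = 1 := by rw [hpstar]; exact inv_mul_cancel₀ (by positivity)
  have hderiv (p : ℝ) : deriv f p = (i : ℝ) * n.choose i * p ^ (i - 1) *
      (1 - p) ^ (n - (j + 1)) * ((1 - p) ^ (j - i + 1) - (r * p) ^ (j - i + 1)) := by
    rw [(hasDerivAt_binomial_interval_prob n i j hij p).deriv, ← hprod, ← hrm, mul_pow,
      show n - i = (n - (j + 1)) + (j - i + 1) by omega, pow_add (1 - p)]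
    have hp : p ^ j = p ^ (i - 1) * p ^ (j - i + 1) := by
      rw [← pow_add]
      congr 1
      omega
    rw [hp]
    ring
  have hfactor (p : ℝ) (h0 : 0 < p) (h1 : p < 1) :
      0 < (i : ℝ) * n.choose i * p ^ (i - 1) * (1 - p) ^ (n - (j + 1)) := by
    have hq : 0 < 1 - p := by linarith
    have hc : 0 < n.choose i := Nat.choose_pos (by omega)
    positivity
  have hmono : StrictMonoOn f (Set.Icc 0 pstar) := by
    refine strictMonoOn_of_deriv_pos (convex_Icc _ _) hcont.continuousOn fun p hp => ?_
    rw [interior_Icc] at hp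
    obtain ⟨h0, h1⟩ := hp
    rw [hderiv]
    refine mul_pos (hfactor p h0 (h1.trans hpstar1)) (sub_pos.2 ?_)
    exact pow_lt_pow_left₀ (by nlinarith) (by positivity) (by omega)
  have hanti : StrictAntiOn f (Set.Icc pstar 1) := by
    refine strictAntiOn_of_deriv_neg (convex_Icc _ _) hcont.continuousOn fun p hp => ?_
    rw [interior_Icc] at hp
    obtain ⟨h0, h1⟩ := hp
    rw [hderiv]
    refine mul_neg_of_pos_of_neg (hfactor p (hpstar0.trans h0) h1) (sub_neg.2 ?_)
    exact pow_lt_pow_left₀ (by nlinarith) (by linarith) (by omega)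
  refine ⟨hcont.continuousOn, hmono, hanti, fun p hp => ?_⟩
  rcases le_total p pstar with h | h
  · exact hmono.monotoneOn ⟨hp.1, h⟩ ⟨hpstar0.le, le_rfl⟩ h
  · exact hanti.antitoneOn ⟨le_rfl, hpstar1.le⟩ ⟨h, hp.2⟩ h
end

section
/- For integers 1 ≤ i ≤ j, set λ* = (∏_{k=i}^{j} k)^{1/(j−i+1)}. Then the function f(λ) = ∑_{x=i}^{j} e^{−λ} λ^x / x! is continuous on [0,∞), strictly increasing on [0, λ*], and strictly decreasing on [λ*, ∞); in particular f attains its maximum over [0,∞) at λ = λ*. -/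
theorem factorial_mul_prod_Icc (m n : ℕ) :
    (m.factorial : ℝ) * ∏ k ∈ Finset.Icc (m + 1) (m + n), (k : ℝ) = ((m + n).factorial : ℝ) := by
  induction n with
  | zero => simp
  | succ n ih =>
    rw [← add_assoc, Finset.prod_Icc_succ_top (by omega), ← mul_assoc, ih, Nat.factorial_succ]
    push_cast
    ring

/-- The derivative of the partial Poisson sums telescopes. -/
theorem hasDerivAt_sum_poisson (m n : ℕ) (x : ℝ) :
    HasDerivAt (fun y : ℝ => ∑ k ∈ Finset.Icc (m + 1) (m + n),
        Real.exp (-y) * y ^ k / (k.factorial : ℝ))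
      (Real.exp (-x) * (x ^ m / (m.factorial : ℝ) - x ^ (m + n) / ((m + n).factorial : ℝ))) x := by
  induction n with
  | zero => simpa using hasDerivAt_const x (0 : ℝ)
  | succ n ih =>
    simp only [← add_assoc, Finset.sum_Icc_succ_top (show m + 1 ≤ m + n + 1 by omega)]
    have hexp : HasDerivAt (fun y : ℝ => Real.exp (-y)) (-Real.exp (-x)) x := by
      simpa using (hasDerivAt_neg x).exp
    have hterm := (hexp.mul (hasDerivAt_pow (m + n + 1) x)).div_const
      ((m + n + 1).factorial : ℝ)
    refine (ih.add hterm).congr_deriv ?_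
    have hfac : ((m + n).factorial : ℝ) ≠ 0 := by positivity
    have hsucc : ((m : ℝ) + n + 1) ≠ 0 := by positivity
    rw [Nat.factorial_succ]
    push_cast
    field_simp
    ring

theorem deriv_sum_poisson (m n : ℕ) (x : ℝ) :
    deriv (fun y : ℝ => ∑ k ∈ Finset.Icc (m + 1) (m + n),
        Real.exp (-y) * y ^ k / (k.factorial : ℝ)) x =
      Real.exp (-x) * x ^ m / ((m + n).factorial : ℝ) *
        (∏ k ∈ Finset.Icc (m + 1) (m + n), (k : ℝ) - x ^ n) := by
  rw [(hasDerivAt_sum_poisson m n x).deriv, ← factorial_mul_prod_Icc m n]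
  have hfac : (m.factorial : ℝ) ≠ 0 := by positivity
  have hprod : ∏ k ∈ Finset.Icc (m + 1) (m + n), (k : ℝ) ≠ 0 := by
    refine right_ne_zero_of_mul (a := (m.factorial : ℝ)) ?_
    rw [factorial_mul_prod_Icc]
    positivity
  rw [pow_add]
  field_simp

/-- For `1 ≤ i ≤ j`, with `λ* = (∏_{k=i}^{j} k)^{1/(j-i+1)}`, the function
`f(λ) = ∑_{x=i}^{j} e^{-λ} λ^x / x!` is continuous on `[0,∞)`, strictly increasing on
`[0,λ*]`, strictly decreasing on `[λ*,∞)`, and attains its maximum over `[0,∞)` at `λ*`. -/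
theorem poisson_interval_prob_unimodal (i j : ℕ) (hi : 1 ≤ i) (hij : i ≤ j) :
    let lamstar : ℝ :=
      (∏ k ∈ Finset.Icc i j, (k : ℝ)) ^ ((1 : ℝ) / ((j : ℝ) - (i : ℝ) + 1))
    let f : ℝ → ℝ := fun lam =>
      ∑ x ∈ Finset.Icc i j, Real.exp (-lam) * lam ^ x / (x.factorial : ℝ)
    ContinuousOn f (Set.Ici 0) ∧ StrictMonoOn f (Set.Icc 0 lamstar) ∧
      StrictAntiOn f (Set.Ici lamstar) ∧ ∀ lam ∈ Set.Ici (0 : ℝ), f lam ≤ f lamstar := by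
  intro lamstar f
  obtain ⟨m, rfl⟩ : ∃ m, i = m + 1 := ⟨i - 1, by omega⟩
  obtain ⟨n, rfl⟩ : ∃ n, j = m + n := ⟨j - m, by omega⟩
  have hn : n ≠ 0 := by omega
  have hprod : 0 < ∏ k ∈ Finset.Icc (m + 1) (m + n), (k : ℝ) :=
    Finset.prod_pos fun k hk => by
      have := (Finset.mem_Icc.mp hk).1
      exact_mod_cast (by omega : 0 < k)
  have hstar : 0 < lamstar := Real.rpow_pos_of_pos hprod _
  have hpow : lamstar ^ n = ∏ k ∈ Finset.Icc (m + 1) (m + n), (k : ℝ) := by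
    have hexponent : (1 : ℝ) / (((m + n : ℕ) : ℝ) - ((m + 1 : ℕ) : ℝ) + 1) = (n : ℝ)⁻¹ := by
      push_cast
      rw [one_div]
      congr 1
      ring
    simp only [lamstar, hexponent]
    exact Real.rpow_inv_natCast_pow hprod.le hn
  have hderiv (x : ℝ) : deriv f x =
      Real.exp (-x) * x ^ m / ((m + n).factorial : ℝ) * (lamstar ^ n - x ^ n) := by
    rw [hpow]
    exact deriv_sum_poisson m n x
  have hcont : Continuous f := by fun_prop
  have hmono : StrictMonoOn f (Set.Icc 0 lamstar) := by
    refine strictMonoOn_of_deriv_pos (convex_Icc _ _) hcont.continuousOn fun x hx => ?_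
    rw [interior_Icc] at hx
    obtain ⟨hx0, hx1⟩ := hx
    rw [hderiv]
    have := sub_pos.mpr (pow_lt_pow_left₀ hx1 hx0.le hn)
    positivity
  have hanti : StrictAntiOn f (Set.Ici lamstar) := by
    refine strictAntiOn_of_deriv_neg (convex_Ici _) hcont.continuousOn fun x hx => ?_
    rw [interior_Ici, Set.mem_Ioi] at hx
    have hx0 : 0 < x := hstar.trans hx
    rw [hderiv]
    exact mul_neg_of_pos_of_neg (by positivity)
      (sub_neg.mpr (pow_lt_pow_left₀ hx hstar.le hn))
  refine ⟨hcont.continuousOn, hmono, hanti, fun x hx => ?_⟩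
  rcases le_total x lamstar with h | h
  · exact hmono.monotoneOn ⟨hx, h⟩ ⟨hstar.le, le_rfl⟩ h
  · exact hanti.antitoneOn Set.self_mem_Ici h h
end

section
/- For integers 0 ≤ i < n ≤ N and 0 ≤ M ≤ N−1, it holds that ∑_{x=0}^{i} C(M,x) C(N−M, n−x) = C(M,i) C(N−M−1, n−i−1) + ∑_{x=0}^{i} C(M+1, x) C(N−M−1, n−x). -/
/-- Moving one element of the population from the second class (of size `K + 1`) to the first
(of size `M`) changes the partial Vandermonde sum up to `i` by a single term. -/
theorem sum_range_choose_mul_choose_succ (M K : ℕ) {n i : ℕ} (hin : i < n) :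
    ∑ x ∈ Finset.range (i + 1), M.choose x * (K + 1).choose (n - x)
      = M.choose i * K.choose (n - i - 1)
        + ∑ x ∈ Finset.range (i + 1), (M + 1).choose x * K.choose (n - x) := by
  induction i with
  | zero =>
    obtain ⟨d, rfl⟩ := Nat.exists_eq_add_of_lt hin
    simp [Nat.choose_succ_succ']
  | succ i ih =>
    obtain ⟨d, rfl⟩ := Nat.exists_eq_add_of_lt hin
    rw [Finset.sum_range_succ, ih (by lia), Finset.sum_range_succ _ (i + 1),
      show i + 1 + d + 1 - i - 1 = d + 1 by lia,
      show i + 1 + d + 1 - (i + 1) = d + 1 by lia, Nat.add_sub_cancel,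
      Nat.choose_succ_succ' K d, Nat.choose_succ_succ' M i]
    ring

/-- Hypergeometric CDF recursion in `M`: for `0 ≤ i < n ≤ N` and `0 ≤ M ≤ N - 1`,
`∑_{x=0}^{i} C(M,x) C(N-M,n-x) = C(M,i) C(N-M-1,n-i-1) + ∑_{x=0}^{i} C(M+1,x) C(N-M-1,n-x)`. -/
theorem hypergeometric_cdf_recursion (n N i M : ℕ) (hin : i < n) (hnN : n ≤ N)
    (hM : M ≤ N - 1) :
    ∑ x ∈ Finset.range (i + 1), M.choose x * (N - M).choose (n - x)
      = M.choose i * (N - M - 1).choose (n - i - 1)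
        + ∑ x ∈ Finset.range (i + 1), (M + 1).choose x * (N - M - 1).choose (n - x) := by
  obtain ⟨K, hK⟩ : ∃ K, N - M = K + 1 := ⟨N - M - 1, by lia⟩
  rw [hK, Nat.add_sub_cancel]
  exact sum_range_choose_mul_choose_succ M K hin
end

section
/- For integers 0 < i ≤ j < n ≤ N and 0 ≤ M ≤ N−1, it holds (as an identity of integers) that ∑_{x=i}^{j} C(M,x) C(N−M, n−x) = C(M,j) C(N−M−1, n−j−1) − C(M,i−1) C(N−M−1, n−i) + ∑_{x=i}^{j} C(M+1, x) C(N−M−1, n−x). -/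
/-- The Pascal rule applied to both sides of a product of binomial coefficients. -/
theorem choose_mul_choose_succ_sub (M K x k : ℕ) :
    (M.choose (x + 1) * (K + 1).choose (k + 1) : ℤ)
      = M.choose (x + 1) * K.choose k - M.choose x * K.choose (k + 1)
        + (M + 1).choose (x + 1) * K.choose (k + 1) := by
  rw [Nat.choose_succ_succ K k, Nat.choose_succ_succ M x]
  push_cast
  ring

/-- Recursion for `C(N,n) P(i ≤ X ≤ j ∣ M)`: for `0 < i ≤ j < n ≤ N` and `0 ≤ M ≤ N - 1`,
as an identity of integers,
`∑_{x=i}^{j} C(M,x) C(N-M,n-x)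
  = C(M,j) C(N-M-1,n-j-1) - C(M,i-1) C(N-M-1,n-i) + ∑_{x=i}^{j} C(M+1,x) C(N-M-1,n-x)`. -/
theorem hypergeometric_interval_recursion (n N i j M : ℕ) (hi : 0 < i) (hij : i ≤ j)
    (hjn : j < n) (hnN : n ≤ N) (hM : M ≤ N - 1) :
    (∑ x ∈ Finset.Icc i j, (M.choose x * (N - M).choose (n - x) : ℤ))
      = (M.choose j * (N - M - 1).choose (n - j - 1) : ℤ)
        - (M.choose (i - 1) * (N - M - 1).choose (n - i) : ℤ)
        + ∑ x ∈ Finset.Icc i j, ((M + 1).choose x * (N - M - 1).choose (n - x) : ℤ) := by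
  obtain ⟨K, rfl⟩ : ∃ K, N = M + (K + 1) := ⟨N - M - 1, by omega⟩
  simp only [Nat.add_sub_cancel_left, Nat.add_sub_cancel]
  clear hnN hM
  obtain ⟨i, rfl⟩ := Nat.exists_eq_succ_of_ne_zero (by omega : i ≠ 0)
  induction j, hij using Nat.le_induction with
  | base =>
    obtain ⟨k, rfl⟩ := Nat.exists_eq_add_of_lt hjn
    simp only [Finset.Icc_self, Finset.sum_singleton, Nat.succ_eq_add_one, Nat.add_sub_cancel]
    rw [show i + 1 + k + 1 - (i + 1) = k + 1 by omega]
    exact choose_mul_choose_succ_sub M K i k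
  | succ j hij ih =>
    obtain ⟨k, rfl⟩ := Nat.exists_eq_add_of_lt hjn
    have hstep := choose_mul_choose_succ_sub M K j k
    specialize ih (by omega)
    rw [Finset.sum_Icc_succ_top (by omega), Finset.sum_Icc_succ_top (by omega), ih,
      show j + 1 + k + 1 - (j + 1) = k + 1 by omega,
      show j + 1 + k + 1 - j - 1 = k + 1 by omega, Nat.add_sub_cancel k 1]
    linarith
end

section
/- For integers 0 < i ≤ j < n ≤ N and 0 ≤ M ≤ N, it holds (as an identity of integers) that ∑_{x=i}^{j} C(M,x) C(N−M, n−x) = ∑_{l=0}^{M−i} C(i−1+l, i−1) C(N−i−l, n−i) − ∑_{k=0}^{M−j−1} C(j+k, j) C(N−1−j−k, n−j−1), where a sum with upper limit below its lower limit is empty (equal to 0). -/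
/-- Passing from `M` to `M + 1` marked elements changes the hypergeometric weights of the interval
`[a + 1, j]` by a telescoping sum. -/
theorem sum_choose_mul_choose_succ_sub (n M K a j : ℕ) (haj : a ≤ j) (hjn : j < n) :
    (∑ x ∈ Finset.Icc (a + 1) j, ((M + 1).choose x * K.choose (n - x) : ℤ))
      = (∑ x ∈ Finset.Icc (a + 1) j, (M.choose x * (K + 1).choose (n - x) : ℤ))
        + (M.choose a * K.choose (n - a - 1) - M.choose j * K.choose (n - j - 1)) := by
  induction j, haj using Nat.le_induction with
  | base => simp
  | succ j haj ih =>
    rw [Finset.sum_Icc_succ_top (by omega), Finset.sum_Icc_succ_top (by omega), ih (by omega)]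
    obtain ⟨d, rfl⟩ : ∃ d, n = j + 1 + (d + 1) := ⟨n - j - 2, by omega⟩
    have h₁ : j + 1 + (d + 1) - (j + 1) = d + 1 := by omega
    have h₂ : j + 1 + (d + 1) - j - 1 = d + 1 := by omega
    simp only [h₁, h₂, Nat.add_sub_cancel, Nat.choose_succ_succ' M j, Nat.choose_succ_succ' K d]
    push_cast
    ring

/-- Extending the sum `∑_{l < M - a} C(a+l,a) f(a+l)` by one step; the new term vanishes when
`M < a`. -/
theorem sum_range_succ_sub_choose_mul (f : ℕ → ℤ) (a M : ℕ) :
    ∑ l ∈ Finset.range (M + 1 - a), ((a + l).choose a : ℤ) * f (a + l)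
      = ∑ l ∈ Finset.range (M - a), ((a + l).choose a : ℤ) * f (a + l) + M.choose a * f M := by
  rcases le_or_gt a M with h | h
  · rw [Nat.sub_add_comm h, Finset.sum_range_succ, Nat.add_sub_cancel' h]
  · rw [Nat.choose_eq_zero_of_lt h, Nat.sub_eq_zero_of_le h, Nat.sub_eq_zero_of_le h.le]
    simp

/-- For `0 < i ≤ j < n ≤ N` and `0 ≤ M ≤ N`, as an identity of integers,
`∑_{x=i}^{j} C(M,x) C(N-M,n-x)
  = ∑_{l=0}^{M-i} C(i-1+l,i-1) C(N-i-l,n-i) - ∑_{k=0}^{M-j-1} C(j+k,j) C(N-1-j-k,n-j-1)`,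
where a sum whose upper limit is below its lower limit is empty. -/
theorem hypergeometric_interval_eq_diff_sums (n N i j M : ℕ) (hi : 0 < i) (hij : i ≤ j)
    (hjn : j < n) (hnN : n ≤ N) (hM : M ≤ N) :
    (∑ x ∈ Finset.Icc i j, (M.choose x * (N - M).choose (n - x) : ℤ))
      = (∑ l ∈ Finset.range (M + 1 - i), ((i - 1 + l).choose (i - 1) * (N - i - l).choose (n - i) : ℤ))
        - ∑ k ∈ Finset.range (M - j), ((j + k).choose j * (N - 1 - j - k).choose (n - j - 1) : ℤ) := by
  obtain ⟨a, rfl⟩ : ∃ a, i = a + 1 := ⟨i - 1, by omega⟩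
  simp only [Nat.add_sub_cancel, Nat.add_sub_add_right, Nat.sub_sub, Nat.add_right_comm a 1,
    Nat.add_comm 1, Nat.add_right_comm j 1]
  clear hi hnN
  induction M with
  | zero =>
    simp only [Nat.zero_sub, Finset.range_zero, Finset.sum_empty, sub_zero]
    refine Finset.sum_eq_zero fun x hx => ?_
    rw [Nat.choose_eq_zero_of_lt (by have := (Finset.mem_Icc.mp hx).1; omega)]
    simp
  | succ M ih =>
    have hK : N - M = N - (M + 1) + 1 := by omega
    have ha := sum_range_succ_sub_choose_mul (fun m => (N - (m + 1)).choose (n - (a + 1))) a M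
    have hj := sum_range_succ_sub_choose_mul (fun m => (N - (m + 1)).choose (n - (j + 1))) j M
    rw [sum_choose_mul_choose_succ_sub n M _ a j (by omega) hjn, ← hK, ih (by omega), ha, hj,
      Nat.sub_sub, Nat.sub_sub]
    ring
end

section
/- For integers 0 ≤ i < n ≤ N, the hypergeometric cumulative distribution function at i is strictly decreasing in M on the range i ≤ M ≤ N−n+i: for every integer M with i ≤ M ≤ N−n+i, ∑_{x=0}^{i} C(M,x) C(N−M, n−x) > ∑_{x=0}^{i} C(M+1, x) C(N−M−1, n−x). -/
/-- Moving one element from the second block to the first lowers the truncated Vandermonde sum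
by exactly `C(M,i) C(K,n-i-1)`. -/
theorem sum_range_choose_mul_choose_succ_right (M K n i : ℕ) (hin : i < n) :
    ∑ x ∈ Finset.range (i + 1), M.choose x * (K + 1).choose (n - x)
      = ∑ x ∈ Finset.range (i + 1), (M + 1).choose x * K.choose (n - x)
        + M.choose i * K.choose (n - i - 1) := by
  induction i with
  | zero =>
    obtain ⟨d, rfl⟩ := Nat.exists_eq_add_of_lt hin
    simp [Nat.choose_succ_succ, add_comm]
  | succ i ih =>
    rw [Finset.sum_range_succ, ih (by omega), Finset.sum_range_succ _ (i + 1)]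
    obtain ⟨d, rfl⟩ := Nat.exists_eq_add_of_lt hin
    have h₁ : i + 1 + d + 1 - i - 1 = d + 1 := by omega
    have h₂ : i + 1 + d + 1 - (i + 1) = d + 1 := by omega
    rw [h₁, h₂, Nat.add_sub_cancel, Nat.choose_succ_succ' K, Nat.choose_succ_succ' M]
    ring

/-- For `0 ≤ i < n ≤ N`, the (unnormalized) hypergeometric CDF at `i` is strictly
decreasing in `M` on the range `i ≤ M ≤ N - n + i`:
`∑_{x=0}^{i} C(M,x) C(N-M,n-x) > ∑_{x=0}^{i} C(M+1,x) C(N-M-1,n-x)`. -/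
theorem hypergeometric_cdf_strict_decrease (n N i : ℕ) (hin : i < n) (hnN : n ≤ N) :
    ∀ M : ℕ, i ≤ M → M ≤ N - n + i →
      ∑ x ∈ Finset.range (i + 1), (M + 1).choose x * (N - M - 1).choose (n - x)
        < ∑ x ∈ Finset.range (i + 1), M.choose x * (N - M).choose (n - x) := by
  intro M hiM hMN
  obtain ⟨K, rfl⟩ : ∃ K, N = M + K + 1 := ⟨N - M - 1, by omega⟩
  have h : M + K + 1 - M = K + 1 := by omega
  rw [h, Nat.add_sub_cancel, sum_range_choose_mul_choose_succ_right M K n i hin]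
  exact Nat.lt_add_of_pos_right
    (Nat.mul_pos (Nat.choose_pos hiM) (Nat.choose_pos (by omega)))
end

section
/- Let a, b ≥ 0 and 0 ≤ x ≤ n ≤ N be integers with n ≥ 1. Then ∑_{M=x}^{N−n+x} C(M,x) C(N−M, n−x) C(a+M, a) C(b+N−M, b) = C(a+x, a) C(b+n−x, b) C(a+b+N+1, a+b+n+1), and consequently for every integer M with x ≤ M ≤ N−n+x, [C(M,x) C(N−M, n−x) C(a+M, a) C(b+N−M, b)] / [∑_{M'=x}^{N−n+x} C(M',x) C(N−M', n−x) C(a+M', a) C(b+N−M', b)] = C(a+M, a+x) C(b+N−M, b+n−x) / C(a+b+N+1, a+b+n+1). That is, the posterior distribution of M obtained from an ABC(a,b,N) prior on M and a HYP(n,M,N) observation x has probability mass function C(a+M,a+x)C(b+N−M,b+n−x)/C(a+b+N+1,a+b+n+1) on x ≤ M ≤ N−n+x. -/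
open Finset in
/-- The Vandermonde convolution for upper indices, read off from
`(1 - X)⁻⁽ᵖ⁺¹⁾ * (1 - X)⁻⁽q⁺¹⁾ = (1 - X)⁻⁽ᵖ⁺q⁺²⁾`. -/
theorem sum_antidiagonal_add_choose_mul_add_choose (p q d : ℕ) :
    ∑ ij ∈ antidiagonal d, (p + ij.1).choose p * (q + ij.2).choose q
      = (p + q + 1 + d).choose (p + q + 1) := by
  have h := congrArg (fun u : (PowerSeries ℤ)ˣ => PowerSeries.coeff d u.val)
    (PowerSeries.invOneSubPow_add (S := ℤ) (p + 1) (q + 1))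
  rw [show p + 1 + (q + 1) = (p + q + 1) + 1 by ring] at h
  simp only [Units.val_mul, PowerSeries.invOneSubPow_val_succ_eq_mk_add_choose,
    PowerSeries.coeff_mul, PowerSeries.coeff_mk] at h
  exact_mod_cast h.symm

/-- Absorption: `C(m, x) C(a + m, a) = C(a + x, a) C(a + m, a + x)`. -/
theorem choose_mul_add_choose (a m x : ℕ) :
    m.choose x * (a + m).choose a = (a + x).choose a * (a + m).choose (a + x) := by
  have h := Nat.choose_mul (n := a + m) (Nat.le_add_right a x)
  simp only [Nat.add_sub_cancel_left] at h
  rw [mul_comm, ← h, mul_comm]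

/-- The joint weight of prior and likelihood factors into a part free of `M` and the posterior
weight. -/
theorem hypergeometric_abc_weight_eq (a b x n N M : ℕ) (hx : x ≤ n) (hnN : n ≤ N)
    (hM : M ≤ N - n + x) :
    M.choose x * (N - M).choose (n - x) * (a + M).choose a * (b + N - M).choose b
      = (a + x).choose a * (b + n - x).choose b *
        ((a + M).choose (a + x) * (b + N - M).choose (b + n - x)) := by
  have h₁ := choose_mul_add_choose a M x
  have h₂ := choose_mul_add_choose b (N - M) (n - x)
  rw [← Nat.add_sub_assoc (by omega), ← Nat.add_sub_assoc hx] at h₂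
  calc _ = (M.choose x * (a + M).choose a) *
        ((N - M).choose (n - x) * (b + N - M).choose b) := by ring
    _ = _ := by rw [h₁, h₂]; ring

theorem sum_Icc_posterior_weight (a b x n N : ℕ) (hx : x ≤ n) (hnN : n ≤ N) :
    ∑ M ∈ Finset.Icc x (N - n + x), (a + M).choose (a + x) * (b + N - M).choose (b + n - x)
      = (a + b + N + 1).choose (a + b + n + 1) := by
  obtain ⟨y, rfl⟩ := Nat.exists_eq_add_of_le hx
  obtain ⟨d, rfl⟩ := Nat.exists_eq_add_of_le hnN
  have h := sum_antidiagonal_add_choose_mul_add_choose (a + x) (b + y) d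
  rw [Finset.Nat.sum_antidiagonal_eq_sum_range_succ_mk] at h
  rw [show a + b + (x + y + d) + 1 = a + x + (b + y) + 1 + d by ring,
    show a + b + (x + y) + 1 = a + x + (b + y) + 1 by ring, ← h,
    ← Finset.Ico_add_one_right_eq_Icc, Finset.sum_Ico_eq_sum_range,
    show x + y + d - (x + y) + x + 1 - x = d + 1 by omega]
  refine Finset.sum_congr rfl fun i hi => ?_
  have hi := Finset.mem_range.mp hi
  rw [show a + (x + i) = a + x + i by ring,
    show b + (x + y + d) - (x + i) = b + y + (d - i) by omega,
    show b + (x + y) - x = b + y by omega]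

/-- The posterior from an `ABC(a,b,N)` prior on `M` and a `HYP(n,M,N)` observation `x`:
`∑_{M=x}^{N-n+x} C(M,x) C(N-M,n-x) C(a+M,a) C(b+N-M,b)
  = C(a+x,a) C(b+n-x,b) C(a+b+N+1,a+b+n+1)`, and consequently the normalized posterior
pmf at `M` is `C(a+M,a+x) C(b+N-M,b+n-x) / C(a+b+N+1,a+b+n+1)` for `x ≤ M ≤ N-n+x`. -/
theorem hypergeometric_abc_posterior (a b x n N : ℕ) (hn : 1 ≤ n) (hx : x ≤ n) (hnN : n ≤ N) :
    (∑ M ∈ Finset.Icc x (N - n + x),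
        M.choose x * (N - M).choose (n - x) * (a + M).choose a * (b + N - M).choose b)
      = (a + x).choose a * (b + n - x).choose b * (a + b + N + 1).choose (a + b + n + 1) ∧
      ∀ M : ℕ, x ≤ M → M ≤ N - n + x →
        ((M.choose x * (N - M).choose (n - x) * (a + M).choose a * (b + N - M).choose b : ℚ) /
            (∑ M' ∈ Finset.Icc x (N - n + x),
              (M'.choose x * (N - M').choose (n - x) * (a + M').choose a *
                (b + N - M').choose b : ℚ)))
          = ((a + M).choose (a + x) * (b + N - M).choose (b + n - x) : ℚ) /
              ((a + b + N + 1).choose (a + b + n + 1) : ℚ) := by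
  have hsum : (∑ M ∈ Finset.Icc x (N - n + x),
        M.choose x * (N - M).choose (n - x) * (a + M).choose a * (b + N - M).choose b)
      = (a + x).choose a * (b + n - x).choose b * (a + b + N + 1).choose (a + b + n + 1) := by
    rw [← sum_Icc_posterior_weight a b x n N hx hnN, Finset.mul_sum]
    exact Finset.sum_congr rfl fun M hM =>
      hypergeometric_abc_weight_eq a b x n N M hx hnN (Finset.mem_Icc.mp hM).2
  refine ⟨hsum, fun M _ hM => ?_⟩
  have hweight := hypergeometric_abc_weight_eq a b x n N M hx hnN hM
  have hpos : 0 < (a + x).choose a * (b + n - x).choose b :=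
    Nat.mul_pos (Nat.choose_pos (by omega)) (Nat.choose_pos (by omega))
  have hne : (((a + x).choose a * (b + n - x).choose b : ℕ) : ℚ) ≠ 0 := by
    exact_mod_cast hpos.ne'
  have hweightQ := congrArg (Nat.cast : ℕ → ℚ) hweight
  have hsumQ := congrArg (Nat.cast : ℕ → ℚ) hsum
  push_cast at hweightQ hsumQ hne
  rw [hweightQ, hsumQ, mul_div_mul_left _ _ hne]
end
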